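/- Let R → S be a faithfully flat ring map and let M be an R-module. If the S-module M ⊗_R S is flat and Mittag-Leffler, then M is flat and Mittag-Leffler as an R-module. -/

import Mathlib

open TensorProduct

universe u

/-- A module `M` over a commutative ring `A` is *Mittag-Leffler* if for every family `(Q a)`
of `A`-modules the canonical map `M ⊗[A] (∀ a, Q a) → ∀ a, M ⊗[A] Q a` is injective. -/
def Module.IsMittagLeffler (A M : Type u) [CommRing A] [AddCommGroup M] [Module A M] : Prop :=
  ∀ (ι : Type u) (Q : ι → Type u) [∀ i, AddCommGroup (Q i)] [∀ i, Module A (Q i)],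
    Function.Injective (TensorProduct.piRightHom A A M Q)

/-- For an `S`-module `P`, the isomorphism `M ⊗[R] P ≃ (S ⊗[R] M) ⊗[S] P` sending `m ⊗ p` to
`(1 ⊗ m) ⊗ p`. -/
noncomputable def TensorProduct.baseChangeTensorEquiv (R S M P : Type*) [CommRing R] [CommRing S]
    [Algebra R S] [AddCommGroup M] [Module R M] [AddCommGroup P] [Module R P] [Module S P]
    [IsScalarTower R S P] : M ⊗[R] P ≃ₗ[R] (S ⊗[R] M) ⊗[S] P :=
  TensorProduct.comm R M P ≪≫ₗ
    ((AlgebraTensorModule.cancelBaseChange R S S P M).symm ≪≫ₗ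
      TensorProduct.comm S P (S ⊗[R] M)).restrictScalars R

@[simp]
lemma TensorProduct.baseChangeTensorEquiv_tmul (R S : Type*) {M P : Type*} [CommRing R]
    [CommRing S] [Algebra R S] [AddCommGroup M] [Module R M] [AddCommGroup P] [Module R P]
    [Module S P] [IsScalarTower R S P] (m : M) (p : P) :
    baseChangeTensorEquiv R S M P (m ⊗ₜ p) = (1 ⊗ₜ m) ⊗ₜ p := by
  simp [baseChangeTensorEquiv]

/-- A flat module which becomes Mittag-Leffler after a faithfully flat base change is
Mittag-Leffler. -/
theorem Module.IsMittagLeffler.of_baseChange (R S : Type u) [CommRing R] [CommRing S] [Algebra R S]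
    [Module.FaithfullyFlat R S] (M : Type u) [AddCommGroup M] [Module R M] [Module.Flat R M]
    (hML : Module.IsMittagLeffler S (S ⊗[R] M)) : Module.IsMittagLeffler R M := by
  intro ι Q _ _
  let f : (∀ i, Q i) →ₗ[R] ∀ i, S ⊗[R] Q i :=
    LinearMap.pi fun i ↦ TensorProduct.mk R S (Q i) 1 ∘ₗ LinearMap.proj i
  have hf : Function.Injective f := fun x y h ↦ funext fun i ↦
    Module.FaithfullyFlat.tensorProduct_mk_injective (A := R) (B := S) (Q i) (congrFun h i)
  have hcomm (i : ι) (x : M ⊗[R] ∀ i, Q i) :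
      piRightHom S S (S ⊗[R] M) (fun i ↦ S ⊗[R] Q i)
        (baseChangeTensorEquiv R S M _ (f.lTensor M x)) i =
      baseChangeTensorEquiv R S M _
        ((TensorProduct.mk R S (Q i) 1).lTensor M (piRightHom R R M Q x i)) := by
    induction x with
    | zero => simp
    | tmul m q => simp [f]
    | add x y hx hy => simp only [map_add, Pi.add_apply, hx, hy]
  intro x y hxy
  apply Module.Flat.lTensor_preserves_injective_linearMap f hf
  apply (baseChangeTensorEquiv R S M _).injective
  apply hML ι fun i ↦ S ⊗[R] Q i
  ext i
  rw [hcomm, hcomm, hxy]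

/-- **Faithfully flat descent of flat Mittag-Leffler modules.** Let `R → S` be a faithfully
flat map of commutative rings and let `M` be an `R`-module.  If the `S`-module `S ⊗[R] M` is
flat and Mittag-Leffler, then `M` is flat and Mittag-Leffler as an `R`-module. -/
theorem ffdescent_flat_mittagLeffler
    (R S : Type u) [CommRing R] [CommRing S] [Algebra R S] [Module.FaithfullyFlat R S]
    (M : Type u) [AddCommGroup M] [Module R M]
    (hflat : Module.Flat S (S ⊗[R] M)) (hML : Module.IsMittagLeffler S (S ⊗[R] M)) :
    Module.Flat R M ∧ Module.IsMittagLeffler R M := by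
  have : Module.Flat R M := Module.Flat.of_flat_tensorProduct R M S
  exact ⟨this, .of_baseChange R S M hML⟩
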